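/- Let μ be a non-Dirac Borel probability measure on [0,∞) with m₁(μ) = 1, and for each n ∈ ℕ let ν_n be a Borel probability measure on [0,∞) realizing μ^{⊠ n}. Then for every γ ∈ (0,1): if m₂(μ) < +∞, then lim_{n→∞} n^{1−γ} m_γ(ν_n) = (Var(μ) · γ)^{γ−1} / Γ(1+γ); and if m₂(μ) = +∞, then lim_{n→∞} n^{1−γ} m_γ(ν_n) = 0. -/

import Mathlib

open MeasureTheory Filter Topology Real

/-- The moment transform `ψ_μ(z) = ∫ z t / (1 - z t) dμ(t)` of a measure on `ℝ`. -/
noncomputable def psi (μ : Measure ℝ) (z : ℝ) : ℝ := ∫ t, z * t / (1 - z * t) ∂μ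

/-- `ν` realizes the `n`-fold free multiplicative convolution `μ^{⊠ n}`: with
`δ = μ({0})`, there is an inverse `χ : (δ-1,0) → (-∞,0)` of `ψ_μ` such that
`ψ_ν(((z+1)/z)^{n-1} · χ(z)^n) = z` on `(δ-1,0)` (this encodes `S_{μ^{⊠n}} = S_μ^n`). -/
def RealizesFreePower (μ ν : Measure ℝ) (n : ℕ) : Prop :=
  ∃ χ : ℝ → ℝ,
    (∀ z ∈ Set.Ioo ((μ {0}).toReal - 1) 0, χ z < 0 ∧ psi μ (χ z) = z) ∧
    (∀ z ∈ Set.Ioo ((μ {0}).toReal - 1) 0,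
      psi ν (((z + 1) / z) ^ (n - 1) * (χ z) ^ n) = z)

/-- The function `s ↦ -ψ_ρ(-s) = ∫ s t / (1 + s t) dρ(t)` on the positive half-line. -/
noncomputable def psiNeg (ρ : Measure ℝ) (s : ℝ) : ℝ := ∫ t, s * t / (1 + s * t) ∂ρ

lemma psi_neg (ρ : Measure ℝ) (s : ℝ) : psi ρ (-s) = -psiNeg ρ s := by
  rw [psi, psiNeg, ← integral_neg]
  refine integral_congr_ae (ae_of_all _ fun t => ?_)
  simp only [neg_mul, sub_neg_eq_add, neg_div]

lemma ae_nonneg_of_measure_Iio {ρ : Measure ℝ} (h : ρ (Set.Iio 0) = 0) : ∀ᵐ t ∂ρ, 0 ≤ t := by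
  rw [ae_iff]
  simpa [Set.Iio] using h

lemma integrable_mul_div_one_add {ρ : Measure ℝ} [IsFiniteMeasure ρ] (h : ∀ᵐ t ∂ρ, 0 ≤ t)
    {s : ℝ} (hs : 0 ≤ s) : Integrable (fun t => s * t / (1 + s * t)) ρ := by
  refine Integrable.of_bound (Measurable.aestronglyMeasurable (by fun_prop)) 1 ?_
  filter_upwards [h] with t ht
  have : 0 ≤ s * t := mul_nonneg hs ht
  rw [Real.norm_of_nonneg (by positivity), div_le_one (by positivity)]
  linarith

lemma psiNeg_nonneg {ρ : Measure ℝ} (h : ∀ᵐ t ∂ρ, 0 ≤ t) {s : ℝ} (hs : 0 ≤ s) :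
    0 ≤ psiNeg ρ s := by
  refine integral_nonneg_of_ae ?_
  filter_upwards [h] with t ht
  have : 0 ≤ s * t := mul_nonneg hs ht
  simp only [Pi.zero_apply]
  positivity

lemma ae_eq_zero_of_psiNeg_eq_zero {ρ : Measure ℝ} [IsFiniteMeasure ρ] (h : ∀ᵐ t ∂ρ, 0 ≤ t)
    {s : ℝ} (hs : 0 < s) (h0 : psiNeg ρ s = 0) : ∀ᵐ t ∂ρ, t = 0 := by
  have h1 : 0 ≤ᵐ[ρ] fun t => s * t / (1 + s * t) := by
    filter_upwards [h] with t ht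
    have : 0 ≤ s * t := mul_nonneg hs.le ht
    simp only [Pi.zero_apply]
    positivity
  have h2 := (integral_eq_zero_iff_of_nonneg_ae h1 (integrable_mul_div_one_add h hs.le)).1 h0
  filter_upwards [h, h2] with t ht h3
  have h4 : 0 < 1 + s * t := by nlinarith
  have h5 : s * t / (1 + s * t) = 0 := h3
  rw [div_eq_zero_iff, or_iff_left h4.ne', mul_eq_zero, or_iff_right hs.ne'] at h5
  exact h5

lemma psiNeg_mono {ρ : Measure ℝ} [IsFiniteMeasure ρ] (h : ∀ᵐ t ∂ρ, 0 ≤ t)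
    {r s : ℝ} (hr : 0 ≤ r) (hrs : r ≤ s) : psiNeg ρ r ≤ psiNeg ρ s := by
  refine integral_mono_ae (integrable_mul_div_one_add h hr)
    (integrable_mul_div_one_add h (hr.trans hrs)) ?_
  filter_upwards [h] with t ht
  have h1 : 0 ≤ r * t := mul_nonneg hr ht
  have h2 : r * t ≤ s * t := mul_le_mul_of_nonneg_right hrs ht
  rw [div_le_div_iff₀ (by positivity) (by linarith)]
  nlinarith

lemma psiNeg_lt {ρ : Measure ℝ} [IsFiniteMeasure ρ] (h : ∀ᵐ t ∂ρ, 0 ≤ t)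
    {r s : ℝ} (hr : 0 < r) (hrs : r < s) (h0 : ¬ ∀ᵐ t ∂ρ, t = 0) :
    psiNeg ρ r < psiNeg ρ s := by
  refine (psiNeg_mono h hr.le hrs.le).lt_of_ne fun heq => h0 ?_
  have hnn : 0 ≤ᵐ[ρ] fun t => s * t / (1 + s * t) - r * t / (1 + r * t) := by
    filter_upwards [h] with t ht
    have h1 : 0 ≤ r * t := mul_nonneg hr.le ht
    have h2 : r * t ≤ s * t := mul_le_mul_of_nonneg_right hrs.le ht
    simp only [Pi.zero_apply, sub_nonneg]
    rw [div_le_div_iff₀ (by positivity) (by linarith)]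
    nlinarith
  have hir := integrable_mul_div_one_add h hr.le
  have his := integrable_mul_div_one_add h (hr.trans hrs).le
  have hz : ∫ t, (s * t / (1 + s * t) - r * t / (1 + r * t)) ∂ρ = 0 := by
    rw [integral_sub his hir]
    exact sub_eq_zero.2 heq.symm
  have h2 := (integral_eq_zero_iff_of_nonneg_ae hnn (his.sub hir)).1 hz
  filter_upwards [h, h2] with t ht h3
  have h1 : 0 ≤ r * t := mul_nonneg hr.le ht
  have h2 : r * t ≤ s * t := mul_le_mul_of_nonneg_right hrs.le ht
  have h5 : s * t / (1 + s * t) = r * t / (1 + r * t) := sub_eq_zero.1 h3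
  rw [div_eq_div_iff (by linarith) (by linarith)] at h5
  have h6 : (s - r) * t = 0 := by linarith
  exact (mul_eq_zero.1 h6).resolve_left (sub_pos.2 hrs).ne'

lemma lintegral_rpow_mul_exp_neg_mul {a r : ℝ} (ha : 0 < a) (hr : 0 < r) :
    ∫⁻ t in Set.Ioi (0 : ℝ), ENNReal.ofReal (t ^ (a - 1) * rexp (-(r * t))) =
      ENNReal.ofReal ((1 / r) ^ a * Gamma a) := by
  rw [← integral_rpow_mul_exp_neg_mul_Ioi ha hr, ofReal_integral_eq_lintegral_ofReal]
  · have := integrableOn_rpow_mul_exp_neg_mul_rpow (p := 1) (s := a - 1) (b := r)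
      (by linarith) one_pos hr
    simpa [IntegrableOn] using this
  · filter_upwards [ae_restrict_mem measurableSet_Ioi] with t ht
    have : (0 : ℝ) < t := ht
    simp only [Pi.zero_apply]
    positivity

lemma lintegral_rpow_mul_div_one_add {γ t : ℝ} (hγ : γ ∈ Set.Ioo (0 : ℝ) 1) (ht : 0 ≤ t) :
    ∫⁻ s in Set.Ioi (0 : ℝ), ENNReal.ofReal (s ^ (-γ - 1) * (s * t / (1 + s * t))) =
      ENNReal.ofReal (Gamma γ * Gamma (1 - γ)) * ENNReal.ofReal (t ^ γ) := by
  obtain ⟨h0, h1⟩ := hγ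
  rcases ht.eq_or_lt with rfl | ht
  · simp [Real.zero_rpow h0.ne']
  have hG := Gamma_pos_of_pos h0
  have hG' := Gamma_pos_of_pos (sub_pos.2 h1)
  have e1 : ∀ s ∈ Set.Ioi (0 : ℝ), ENNReal.ofReal (s ^ (-γ - 1) * (s * t / (1 + s * t))) =
      ∫⁻ v in Set.Ioi (0 : ℝ), ENNReal.ofReal (s ^ (-γ) * t * rexp (-((1 + s * t) * v))) := by
    intro s hs
    have hs : 0 < s := hs
    have hst : 0 < 1 + s * t := by positivity
    have := lintegral_rpow_mul_exp_neg_mul (a := 1) one_pos hst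
    simp only [sub_self, rpow_zero, one_mul, rpow_one, Real.Gamma_one, mul_one] at this
    simp_rw [fun v : ℝ => ENNReal.ofReal_mul (p := s ^ (-γ) * t)
      (q := rexp (-((1 + s * t) * v))) (by positivity)]
    rw [lintegral_const_mul' _ _ ENNReal.ofReal_ne_top, this,
      ← ENNReal.ofReal_mul (by positivity)]
    congr 1
    rw [rpow_sub_one hs.ne']
    field_simp
  rw [setLIntegral_congr_fun measurableSet_Ioi e1, lintegral_lintegral_swap (by fun_prop)]
  have e2 : ∀ v ∈ Set.Ioi (0 : ℝ),
      ∫⁻ s in Set.Ioi (0 : ℝ), ENNReal.ofReal (s ^ (-γ) * t * rexp (-((1 + s * t) * v))) =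
      ENNReal.ofReal (Gamma (1 - γ) * t ^ γ) *
        ENNReal.ofReal (v ^ (γ - 1) * rexp (-(1 * v))) := by
    intro v hv
    have hv : 0 < v := hv
    have := lintegral_rpow_mul_exp_neg_mul (a := 1 - γ) (r := t * v) (sub_pos.2 h1)
      (by positivity)
    have e3 : ∀ s : ℝ, ENNReal.ofReal (s ^ (-γ) * t * rexp (-((1 + s * t) * v))) =
        ENNReal.ofReal (t * rexp (-v)) *
          ENNReal.ofReal (s ^ (1 - γ - 1) * rexp (-(t * v * s))) := by
      intro s
      rw [← ENNReal.ofReal_mul (by positivity)]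
      congr 1
      have : -((1 + s * t) * v) = -v + -(t * v * s) := by ring
      rw [this, exp_add, show 1 - γ - 1 = -γ by ring]
      ring
    simp_rw [e3]
    rw [lintegral_const_mul' _ _ ENNReal.ofReal_ne_top, this,
      ← ENNReal.ofReal_mul (by positivity), ← ENNReal.ofReal_mul (by positivity)]
    congr 1
    rw [one_div, inv_rpow (by positivity), ← rpow_neg (by positivity), neg_sub,
      mul_rpow ht.le hv.le, rpow_sub_one ht.ne']
    field_simp
  rw [setLIntegral_congr_fun measurableSet_Ioi e2,
    lintegral_const_mul' _ _ ENNReal.ofReal_ne_top, lintegral_rpow_mul_exp_neg_mul h0 one_pos,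
    ← ENNReal.ofReal_mul (by positivity), ← ENNReal.ofReal_mul (by positivity)]
  congr 1
  rw [div_one, one_rpow]
  ring

lemma lintegral_rpow_mul_psiNeg {ρ : Measure ℝ} [IsFiniteMeasure ρ] (h : ∀ᵐ t ∂ρ, 0 ≤ t)
    {γ : ℝ} (hγ : γ ∈ Set.Ioo (0 : ℝ) 1) :
    ∫⁻ s in Set.Ioi (0 : ℝ), ENNReal.ofReal (s ^ (-γ - 1)) * ENNReal.ofReal (psiNeg ρ s) =
      ENNReal.ofReal (Gamma γ * Gamma (1 - γ)) * ∫⁻ t, ENNReal.ofReal (t ^ γ) ∂ρ := by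
  have e1 : ∀ s ∈ Set.Ioi (0 : ℝ),
      ENNReal.ofReal (s ^ (-γ - 1)) * ENNReal.ofReal (psiNeg ρ s) =
        ∫⁻ t, ENNReal.ofReal (s ^ (-γ - 1) * (s * t / (1 + s * t))) ∂ρ := by
    intro s hs
    have hs : 0 < s := hs
    rw [psiNeg, ofReal_integral_eq_lintegral_ofReal (integrable_mul_div_one_add h hs.le),
      ← lintegral_const_mul' _ _ ENNReal.ofReal_ne_top]
    · simp_rw [ENNReal.ofReal_mul (rpow_nonneg hs.le _)]
    · filter_upwards [h] with t ht
      have : 0 ≤ s * t := mul_nonneg hs.le ht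
      simp only [Pi.zero_apply]
      positivity
  rw [setLIntegral_congr_fun measurableSet_Ioi e1, lintegral_lintegral_swap (by fun_prop),
    ← lintegral_const_mul' _ _ ENNReal.ofReal_ne_top]
  refine lintegral_congr_ae ?_
  filter_upwards [h] with t ht using lintegral_rpow_mul_div_one_add hγ ht

lemma lintegral_Ioi_rpow_neg_sub_one {γ a : ℝ} (hγ : 0 < γ) (ha : 0 < a) :
    ∫⁻ s in Set.Ioi a, ENNReal.ofReal (s ^ (-γ - 1)) = ENNReal.ofReal (a ^ (-γ) / γ) := by
  rw [← ofReal_integral_eq_lintegral_ofReal, integral_Ioi_rpow_of_lt (by linarith) ha]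
  · congr 1
    rw [sub_add_cancel, neg_div_neg_eq]
  · exact integrableOn_Ioi_rpow_of_lt (by linarith) ha
  · filter_upwards [ae_restrict_mem measurableSet_Ioi] with t ht
    exact rpow_nonneg (ha.trans ht).le _

/-- Layer-cake formula expressing a fractional moment through the inverse `σ` of `psiNeg ρ`. -/
lemma lintegral_rpow_eq_of_inverse {ρ : Measure ℝ} [IsFiniteMeasure ρ] (h : ∀ᵐ t ∂ρ, 0 ≤ t)
    {γ D : ℝ} (hγ : γ ∈ Set.Ioo (0 : ℝ) 1) {σ : ℝ → ℝ} (hσ : ∀ x ∈ Set.Ioo 0 D, 0 < σ x)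
    (hinv : ∀ x ∈ Set.Ioo 0 D, psiNeg ρ (σ x) = x) (hD : ∀ s, 0 < s → psiNeg ρ s ≤ D) :
    ENNReal.ofReal (Gamma γ * Gamma (1 - γ)) * ∫⁻ t, ENNReal.ofReal (t ^ γ) ∂ρ =
      ∫⁻ x in Set.Ioo 0 D, ENNReal.ofReal (σ x ^ (-γ) / γ) := by
  have hm : Measurable (psiNeg ρ) := by
    have : Measurable fun p : ℝ × ℝ => p.1 * p.2 / (1 + p.1 * p.2) := by fun_prop
    exact this.stronglyMeasurable.integral_prod_right.measurable
  rw [← lintegral_rpow_mul_psiNeg h hγ]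
  have e1 : ∀ s ∈ Set.Ioi (0 : ℝ),
      ENNReal.ofReal (s ^ (-γ - 1)) * ENNReal.ofReal (psiNeg ρ s) =
        ∫⁻ x in Set.Ioo 0 D, {p : ℝ × ℝ | p.2 < psiNeg ρ p.1}.indicator
          (fun p => ENNReal.ofReal (p.1 ^ (-γ - 1))) (s, x) := by
    intro s hs
    have e2 : (fun x => {p : ℝ × ℝ | p.2 < psiNeg ρ p.1}.indicator
          (fun p => ENNReal.ofReal (p.1 ^ (-γ - 1))) (s, x)) =
        (Set.Iio (psiNeg ρ s)).indicator (fun _ => ENNReal.ofReal (s ^ (-γ - 1))) := by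
      ext x
      simp [Set.indicator]
    rw [e2, lintegral_indicator measurableSet_Iio, setLIntegral_const,
      Measure.restrict_apply measurableSet_Iio]
    congr 1
    have : Set.Iio (psiNeg ρ s) ∩ Set.Ioo 0 D = Set.Ioo 0 (psiNeg ρ s) := by
      ext x
      have := hD s hs
      simp only [Set.mem_inter_iff, Set.mem_Iio, Set.mem_Ioo]
      constructor
      · rintro ⟨h1, h2, -⟩
        exact ⟨h2, h1⟩
      · rintro ⟨h1, h2⟩
        exact ⟨h2, h1, h2.trans_le this⟩
    rw [this, volume_Ioo, sub_zero]
  rw [setLIntegral_congr_fun measurableSet_Ioi e1, lintegral_lintegral_swap]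
  · refine setLIntegral_congr_fun measurableSet_Ioo fun x hx => ?_
    have hσx := hσ x hx
    have hnt : ¬ ∀ᵐ t ∂ρ, t = 0 := by
      intro h0
      have : psiNeg ρ (σ x) = 0 := by
        rw [psiNeg]
        refine integral_eq_zero_of_ae ?_
        filter_upwards [h0] with t ht
        simp [ht]
      rw [hinv x hx] at this
      exact hx.1.ne' this
    rw [← lintegral_Ioi_rpow_neg_sub_one hγ.1 hσx, ← lintegral_indicator measurableSet_Ioi,
      ← lintegral_indicator measurableSet_Ioi]
    refine lintegral_congr fun s => ?_
    simp only [Set.indicator, Set.mem_Ioi, Set.mem_ofPred_eq]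
    by_cases hs : 0 < s
    · have : x < psiNeg ρ s ↔ σ x < s := by
        constructor
        · intro h1
          by_contra! h2
          have := psiNeg_mono h hs.le h2
          rw [hinv x hx] at this
          exact absurd h1 this.not_gt
        · intro h1
          have := psiNeg_lt h hσx h1 hnt
          rwa [hinv x hx] at this
      simp [hs, this]
    · have : ¬ σ x < s := fun h1 => hs (hσx.trans h1)
      simp [hs, this]
  · refine (Measurable.indicator (by fun_prop) ?_).aemeasurable
    exact measurableSet_lt measurable_snd (hm.comp measurable_fst)

lemma sq_one_sub_div_one_add_mul_bound {u t : ℝ} (hu : 0 < u) (ht : 0 ≤ t) :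
    (1 - t) ^ 2 / (1 + u * t) ≤ 1 + t / u := by
  have h1 : 0 ≤ u * t := mul_nonneg hu.le ht
  rw [div_le_iff₀ (by positivity)]
  have : (1 + t / u) * (1 + u * t) = 1 + u * t + t / u + t ^ 2 := by
    field_simp
    ring
  rw [this]
  have : 0 ≤ t / u := by positivity
  nlinarith

lemma integrable_sq_one_sub_div {μ : Measure ℝ} [IsFiniteMeasure μ] (h : ∀ᵐ t ∂μ, 0 ≤ t)
    (hm1 : Integrable (fun t : ℝ => t) μ) {u : ℝ} (hu : 0 < u) :
    Integrable (fun t => (1 - t) ^ 2 / (1 + u * t)) μ := by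
  refine Integrable.mono' (g := fun t => 1 + t / u) ((integrable_const 1).add (hm1.div_const u))
    (Measurable.aestronglyMeasurable (by fun_prop)) ?_
  filter_upwards [h] with t ht
  have h1 : 0 ≤ u * t := mul_nonneg hu.le ht
  rw [Real.norm_of_nonneg (by positivity)]
  exact sq_one_sub_div_one_add_mul_bound hu ht

lemma one_sub_psiNeg_mul_sub {μ : Measure ℝ} [IsProbabilityMeasure μ] (h : ∀ᵐ t ∂μ, 0 ≤ t)
    (hm1 : Integrable (fun t : ℝ => t) μ) (hmean : ∫ t, t ∂μ = 1) {u : ℝ} (hu : 0 < u) :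
    (1 - psiNeg μ u) * u - psiNeg μ u =
      u ^ 2 / (1 + u) * ∫ t, (1 - t) ^ 2 / (1 + u * t) ∂μ := by
  have hi := integrable_mul_div_one_add h hu.le
  have hA := integrable_sq_one_sub_div h hm1 hu
  have e1 : ∫ t, (u / (1 + u) * (1 - t) + u ^ 2 / (1 + u) * ((1 - t) ^ 2 / (1 + u * t))) ∂μ =
      ∫ t, (u - (1 + u) * (u * t / (1 + u * t))) ∂μ := by
    refine integral_congr_ae ?_
    filter_upwards [h] with t ht
    have h1 : 0 ≤ u * t := mul_nonneg hu.le ht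
    have h2 : 1 + u * t ≠ 0 := by positivity
    field_simp
    ring
  have h1t : Integrable (fun t : ℝ => 1 - t) μ := (integrable_const 1).sub hm1
  rw [integral_add (h1t.const_mul _) (hA.const_mul _),
    integral_const_mul, integral_const_mul, integral_sub (integrable_const 1) hm1, hmean,
    integral_sub (integrable_const u) (hi.const_mul _), integral_const_mul] at e1
  simp only [integral_const, probReal_univ, smul_eq_mul, one_mul, sub_self, mul_zero,
    zero_add] at e1
  rw [e1, ← psiNeg]
  ring

lemma psiNeg_le_self {μ : Measure ℝ} [IsProbabilityMeasure μ] (h : ∀ᵐ t ∂μ, 0 ≤ t)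
    (hm1 : Integrable (fun t : ℝ => t) μ) (hmean : ∫ t, t ∂μ = 1) {u : ℝ} (hu : 0 < u) :
    psiNeg μ u ≤ u := by
  have : ∫ t, u * t ∂μ = u := by rw [integral_const_mul, hmean, mul_one]
  rw [psiNeg]
  conv_rhs => rw [← this]
  refine integral_mono_ae (integrable_mul_div_one_add h hu.le) (hm1.const_mul u) ?_
  filter_upwards [h] with t ht
  have h1 : 0 ≤ u * t := mul_nonneg hu.le ht
  exact div_le_self h1 (by linarith)

lemma psiNeg_le_one_sub_measure_zero {μ : Measure ℝ} [IsProbabilityMeasure μ]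
    (h : ∀ᵐ t ∂μ, 0 ≤ t) {u : ℝ} (hu : 0 < u) : psiNeg μ u ≤ 1 - (μ {0}).toReal := by
  have e : ∫ t, ({0}ᶜ : Set ℝ).indicator (fun _ => (1 : ℝ)) t ∂μ = 1 - (μ {0}).toReal := by
    rw [integral_indicator (measurableSet_singleton 0).compl, setIntegral_const, smul_eq_mul,
      mul_one, probReal_compl_eq_one_sub (measurableSet_singleton 0)]
    rfl
  rw [← e]
  refine integral_mono_ae (integrable_mul_div_one_add h hu.le)
    ((integrable_const 1).indicator (measurableSet_singleton 0).compl) ?_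
  filter_upwards [h] with t ht
  have h1 : 0 ≤ u * t := mul_nonneg hu.le ht
  by_cases h0 : t = 0
  · simp [h0]
  · have : t ∈ ({0}ᶜ : Set ℝ) := h0
    rw [Set.indicator_of_mem this, div_le_one (by positivity)]
    linarith

lemma integral_sq_one_sub_div_pos {μ : Measure ℝ} [IsProbabilityMeasure μ]
    (h : ∀ᵐ t ∂μ, 0 ≤ t) (hnd : ∀ a : ℝ, μ ≠ Measure.dirac a)
    (hm1 : Integrable (fun t : ℝ => t) μ) : 0 < ∫ t, (1 - t) ^ 2 / (1 + 1 * t) ∂μ := by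
  have hnn : 0 ≤ᵐ[μ] fun t => (1 - t) ^ 2 / (1 + 1 * t) := by
    filter_upwards [h] with t ht
    simp only [Pi.zero_apply]
    positivity
  refine (integral_nonneg_of_ae hnn).lt_of_ne fun h0 => hnd 1 ?_
  have h2 := (integral_eq_zero_iff_of_nonneg_ae hnn
    (integrable_sq_one_sub_div h hm1 one_pos)).1 h0.symm
  have h3 : (fun t : ℝ => t) =ᵐ[μ] fun _ => (1 : ℝ) := by
    filter_upwards [h, h2] with t ht h3
    have h4 : (1 - t) ^ 2 / (1 + 1 * t) = 0 := h3
    rw [div_eq_zero_iff, or_iff_left (by positivity)] at h4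
    have := pow_eq_zero_iff (two_ne_zero) |>.1 h4
    linarith
  have h4 : μ.map (fun t => t) = μ.map fun _ => (1 : ℝ) := Measure.map_congr h3
  rw [Measure.map_const, measure_univ, one_smul] at h4
  exact Measure.map_id'.symm.trans h4

/-- Linear lower bound for the `S`-transform at `-ψ(u)`. -/
lemma le_one_sub_div_mul_sub_one {μ : Measure ℝ} [IsProbabilityMeasure μ]
    (h : ∀ᵐ t ∂μ, 0 ≤ t) (hm1 : Integrable (fun t : ℝ => t) μ) (hmean : ∫ t, t ∂μ = 1)
    {u : ℝ} (hu : 0 < u) (hx : 0 < psiNeg μ u) :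
    1 + (∫ t, (1 - t) ^ 2 / (1 + 1 * t) ∂μ) / 4 * psiNeg μ u ≤
      (1 - psiNeg μ u) / psiNeg μ u * u := by
  have key := one_sub_psiNeg_mul_sub h hm1 hmean hu
  have hxu := psiNeg_le_self h hm1 hmean hu
  have hx1 : psiNeg μ u ≤ 1 := (psiNeg_le_one_sub_measure_zero h hu).trans
    (sub_le_self _ ENNReal.toReal_nonneg)
  have hA0 : 0 ≤ ∫ t, (1 - t) ^ 2 / (1 + 1 * t) ∂μ := by
    refine integral_nonneg_of_ae ?_
    filter_upwards [h] with t ht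
    simp only [Pi.zero_apply]
    positivity
  have hA : (∫ t, (1 - t) ^ 2 / (1 + 1 * t) ∂μ) / (1 + u) ≤
      ∫ t, (1 - t) ^ 2 / (1 + u * t) ∂μ := by
    rw [← integral_div]
    refine integral_mono_ae ((integrable_sq_one_sub_div h hm1 one_pos).div_const _)
      (integrable_sq_one_sub_div h hm1 hu) ?_
    filter_upwards [h] with t ht
    have h1 : 0 ≤ u * t := mul_nonneg hu.le ht
    rw [div_div]
    exact div_le_div_of_nonneg_left (sq_nonneg _) (by positivity) (by nlinarith)
  set x := psiNeg μ u
  set A0 := ∫ t, (1 - t) ^ 2 / (1 + 1 * t) ∂μ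
  set A := ∫ t, (1 - t) ^ 2 / (1 + u * t) ∂μ
  have h1 : x * (1 + u) ≤ 2 * u := by nlinarith
  have h2 : (x * (1 + u)) ^ 2 ≤ (2 * u) ^ 2 := pow_le_pow_left₀ (by positivity) h1 2
  have h3 : A0 / 4 * x ^ 2 ≤ u ^ 2 / (1 + u) * (A0 / (1 + u)) := by
    rw [div_mul_div_comm, le_div_iff₀ (by positivity)]
    nlinarith
  have h4 : u ^ 2 / (1 + u) * (A0 / (1 + u)) ≤ (1 - x) * u - x := by
    rw [key]
    gcongr
  rw [div_mul_eq_mul_div (1 - x), le_div_iff₀ hx]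
  nlinarith

lemma tendsto_psiNeg_div_self {μ : Measure ℝ} [IsProbabilityMeasure μ] (h : ∀ᵐ t ∂μ, 0 ≤ t)
    (hm1 : Integrable (fun t : ℝ => t) μ) (hmean : ∫ t, t ∂μ = 1) :
    Tendsto (fun u => psiNeg μ u / u) (𝓝[>] 0) (𝓝 1) := by
  have e : ∀ᶠ u : ℝ in 𝓝[>] 0, ∫ t, t / (1 + u * t) ∂μ = psiNeg μ u / u := by
    filter_upwards [self_mem_nhdsWithin] with u hu
    have hu : 0 < u := hu
    rw [psiNeg, ← integral_div]
    refine integral_congr_ae (ae_of_all _ fun t => ?_)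
    simp only
    field_simp
  refine Tendsto.congr' e ?_
  conv => enter [3, 1]; rw [← hmean]
  refine tendsto_integral_filter_of_dominated_convergence (fun t => t)
    (.of_forall fun u => Measurable.aestronglyMeasurable (by fun_prop)) ?_ hm1 ?_
  · filter_upwards [self_mem_nhdsWithin] with u hu
    have hu : 0 < u := hu
    filter_upwards [h] with t ht
    have h1 : 0 ≤ u * t := mul_nonneg hu.le ht
    rw [Real.norm_of_nonneg (by positivity)]
    exact div_le_self ht (by linarith)
  · refine ae_of_all _ fun t => ?_
    have : ContinuousAt (fun u : ℝ => t / (1 + u * t)) 0 := by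
      refine ContinuousAt.div (by fun_prop) (by fun_prop) (by simp)
    have := this.tendsto
    simp only [zero_mul, add_zero, div_one] at this
    exact this.mono_left nhdsWithin_le_nhds

lemma tendsto_sq_one_sub_div (t : ℝ) :
    Tendsto (fun u : ℝ => (1 - t) ^ 2 / (1 + u * t)) (𝓝[>] 0) (𝓝 ((1 - t) ^ 2)) := by
  have : ContinuousAt (fun u : ℝ => (1 - t) ^ 2 / (1 + u * t)) 0 :=
    ContinuousAt.div (by fun_prop) (by fun_prop) (by simp)
  have := this.tendsto
  simp only [zero_mul, add_zero, div_one] at this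
  exact this.mono_left nhdsWithin_le_nhds

lemma tendsto_integral_sq_one_sub_div {μ : Measure ℝ} [IsProbabilityMeasure μ]
    (h : ∀ᵐ t ∂μ, 0 ≤ t) (hm2 : Integrable (fun t : ℝ => (1 - t) ^ 2) μ) :
    Tendsto (fun u => ∫ t, (1 - t) ^ 2 / (1 + u * t) ∂μ) (𝓝[>] 0)
      (𝓝 (∫ t, (1 - t) ^ 2 ∂μ)) := by
  refine tendsto_integral_filter_of_dominated_convergence (fun t => (1 - t) ^ 2)
    (.of_forall fun u => Measurable.aestronglyMeasurable (by fun_prop)) ?_ hm2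
    (ae_of_all _ tendsto_sq_one_sub_div)
  filter_upwards [self_mem_nhdsWithin] with u hu
  have hu : 0 < u := hu
  filter_upwards [h] with t ht
  have h1 : 0 ≤ u * t := mul_nonneg hu.le ht
  rw [Real.norm_of_nonneg (by positivity)]
  exact div_le_self (sq_nonneg _) (by linarith)

lemma tendsto_integral_sq_one_sub_div_atTop {μ : Measure ℝ} [IsProbabilityMeasure μ]
    (h : ∀ᵐ t ∂μ, 0 ≤ t) (hm1 : Integrable (fun t : ℝ => t) μ)
    (hm2 : ¬ Integrable (fun t : ℝ => (1 - t) ^ 2) μ) :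
    Tendsto (fun u => ∫ t, (1 - t) ^ 2 / (1 + u * t) ∂μ) (𝓝[>] 0) atTop := by
  rw [← ENNReal.tendsto_ofReal_nhds_top]
  have e : ∀ᶠ u : ℝ in 𝓝[>] 0, ∫⁻ t, ENNReal.ofReal ((1 - t) ^ 2 / (1 + u * t)) ∂μ =
      ENNReal.ofReal (∫ t, (1 - t) ^ 2 / (1 + u * t) ∂μ) := by
    filter_upwards [self_mem_nhdsWithin] with u hu
    have hu : 0 < u := hu
    rw [ofReal_integral_eq_lintegral_ofReal (integrable_sq_one_sub_div h hm1 hu)]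
    filter_upwards [h] with t ht
    have h1 : 0 ≤ u * t := mul_nonneg hu.le ht
    simp only [Pi.zero_apply]
    positivity
  refine Tendsto.congr' e ?_
  have htop : ∫⁻ t, ENNReal.ofReal ((1 - t) ^ 2) ∂μ = ⊤ := by
    by_contra hne
    refine hm2 ⟨Measurable.aestronglyMeasurable (by fun_prop), ?_⟩
    rw [hasFiniteIntegral_iff_ofReal (ae_of_all _ fun t => sq_nonneg _)]
    exact lt_top_iff_ne_top.2 hne
  have fatou := lintegral_liminf_le (μ := μ) (u := 𝓝[>] (0 : ℝ))
    (f := fun u t => ENNReal.ofReal ((1 - t) ^ 2 / (1 + u * t))) fun u => by fun_prop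
  have e2 : ∀ t : ℝ, liminf (fun u : ℝ => ENNReal.ofReal ((1 - t) ^ 2 / (1 + u * t))) (𝓝[>] 0) =
      ENNReal.ofReal ((1 - t) ^ 2) := fun t =>
    ((ENNReal.continuous_ofReal.tendsto _).comp (tendsto_sq_one_sub_div t)).liminf_eq
  simp_rw [e2] at fatou
  rw [htop] at fatou
  exact tendsto_of_le_liminf_of_limsup_le fatou le_top

/-- First-order expansion at `0` of the `S`-transform, written along `x = ψ(u)`. -/
lemma tendsto_S_sub_one_div {μ : Measure ℝ} [IsProbabilityMeasure μ]
    (h : ∀ᵐ t ∂μ, 0 ≤ t) (hm1 : Integrable (fun t : ℝ => t) μ) (hmean : ∫ t, t ∂μ = 1)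
    {ι : Type*} {l : Filter ι} {u : ι → ℝ} (hu : Tendsto u l (𝓝[>] 0)) :
    ∃ w : ι → ℝ, Tendsto w l (𝓝 1) ∧ ∀ᶠ i in l, 0 < psiNeg μ (u i) →
      ((1 - psiNeg μ (u i)) / psiNeg μ (u i) * u i - 1) / psiNeg μ (u i) =
        w i * ∫ t, (1 - t) ^ 2 / (1 + u i * t) ∂μ := by
  refine ⟨fun i => 1 / (1 + u i) * ((psiNeg μ (u i) / u i)⁻¹) ^ 2, ?_, ?_⟩
  · have h1 := (tendsto_psiNeg_div_self h hm1 hmean).comp hu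
    have h2 : Tendsto u l (𝓝 0) := hu.mono_right nhdsWithin_le_nhds
    have h3 := ((tendsto_const_nhds (x := (1 : ℝ))).div (h2.const_add 1) (by simp)).mul
      ((h1.inv₀ one_ne_zero).pow 2)
    simpa using h3
  · filter_upwards [hu self_mem_nhdsWithin] with i hi hx
    have hi : 0 < u i := hi
    have key := one_sub_psiNeg_mul_sub h hm1 hmean hi
    have e : ((1 - psiNeg μ (u i)) / psiNeg μ (u i) * u i - 1) / psiNeg μ (u i) =
        ((1 - psiNeg μ (u i)) * u i - psiNeg μ (u i)) / psiNeg μ (u i) ^ 2 := by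
      field_simp
    rw [e, key]
    field_simp

lemma quasiMeasurePreserving_const_mul {a : ℝ} (ha : a ≠ 0) :
    Measure.QuasiMeasurePreserving (fun x : ℝ => a * x) volume volume := by
  refine ⟨by fun_prop, ?_⟩
  rw [Real.map_volume_mul_left ha]
  exact Measure.smul_absolutelyContinuous

/-- Laplace-type asymptotics for the integrals `∫ (x / (1 - x) · S(x)^n)^{-γ} dx`. -/
lemma tendsto_rpow_mul_integral {γ D c : ℝ} (hγ : γ ∈ Set.Ioo (0 : ℝ) 1) (hD : 0 < D)
    (hD1 : D ≤ 1) (hc : 0 < c) {S φ : ℝ → ℝ}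
    (hSm : AEMeasurable S (volume.restrict (Set.Ioo 0 D)))
    (hS : ∀ x ∈ Set.Ioo 0 D, 1 + c * x ≤ S x)
    (hφ : ∀ y, 0 < y → Tendsto (fun n : ℕ => (S ((n : ℝ)⁻¹ * y) ^ n) ^ (-γ)) atTop (𝓝 (φ y))) :
    Tendsto (fun n : ℕ => (n : ℝ) ^ (1 - γ) *
        ∫ x in Set.Ioo 0 D, (x / (1 - x) * S x ^ n) ^ (-γ)) atTop
      (𝓝 (∫ y in Set.Ioi 0, y ^ (-γ) * φ y)) := by
  obtain ⟨h0, h1⟩ := hγ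
  set H : ℕ → ℝ → ℝ := fun n =>
    (Set.Ioo 0 D).indicator fun x => (x / (1 - x) * S x ^ n) ^ (-γ) with hH
  have hsub : Set.Ioo 0 D ⊆ Set.Ioi 0 := fun x hx => hx.1
  have e1 : ∀ᶠ n : ℕ in atTop,
      ∫ y in Set.Ioi (0 : ℝ), (n : ℝ) ^ (-γ) * H n ((n : ℝ)⁻¹ * y) =
        (n : ℝ) ^ (1 - γ) * ∫ x in Set.Ioo 0 D, (x / (1 - x) * S x ^ n) ^ (-γ) := by
    filter_upwards [eventually_ge_atTop 1] with n hn
    have hn0 : (0 : ℝ) < n := by exact_mod_cast hn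
    rw [integral_const_mul, integral_comp_mul_left_Ioi _ _ (inv_pos.2 hn0), mul_zero, inv_inv,
      smul_eq_mul, setIntegral_indicator measurableSet_Ioo, Set.inter_eq_right.2 hsub,
      ← mul_assoc, ← rpow_add_one hn0.ne']
    ring_nf
  refine Tendsto.congr' e1 ?_
  set c' := c / (1 + c) with hc'
  have hc'0 : 0 < c' := by positivity
  have hexp : ∀ x ∈ Set.Ioo 0 D, rexp (c' * x) ≤ S x := by
    intro x hx
    have hx0 := hx.1
    have hx1 : x ≤ 1 := (hx.2.trans_le hD1).le
    have hpos : 0 < 1 + c * x := by positivity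
    refine le_trans ?_ (hS x hx)
    rw [← le_log_iff_exp_le hpos]
    refine le_trans ?_ (one_sub_inv_le_log_of_pos hpos)
    have : 1 - (1 + c * x)⁻¹ = c * x / (1 + c * x) := by
      field_simp
      ring
    rw [this, hc', div_mul_eq_mul_div]
    exact div_le_div_of_nonneg_left (by positivity) hpos (by nlinarith)
  have hev : ∀ y : ℝ, 0 < y → ∀ᶠ n : ℕ in atTop, (n : ℝ)⁻¹ * y ∈ Set.Ioo 0 D := by
    intro y hy
    have h2 : Tendsto (fun n : ℕ => (n : ℝ)⁻¹ * y) atTop (𝓝 0) := by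
      simpa using (tendsto_inv_atTop_nhds_zero_nat (𝕜 := ℝ)).mul_const y
    filter_upwards [eventually_ge_atTop 1, h2.eventually (gt_mem_nhds hD)] with n hn h3
    have hn0 : (0 : ℝ) < n := by exact_mod_cast hn
    exact ⟨by positivity, h3⟩
  have hval : ∀ (n : ℕ) (y : ℝ), 1 ≤ n → (n : ℝ)⁻¹ * y ∈ Set.Ioo 0 D →
      (n : ℝ) ^ (-γ) * H n ((n : ℝ)⁻¹ * y) =
        (y / (1 - (n : ℝ)⁻¹ * y)) ^ (-γ) * (S ((n : ℝ)⁻¹ * y) ^ n) ^ (-γ) := by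
    intro n y hn hx
    have hn0 : (0 : ℝ) < n := by exact_mod_cast hn
    have hx1 : 0 < 1 - (n : ℝ)⁻¹ * y := sub_pos.2 (hx.2.trans_le hD1)
    have hS0 : 0 < S ((n : ℝ)⁻¹ * y) := (exp_pos _).trans_le (hexp _ hx)
    have hx0 := hx.1
    have hy0 : 0 < y := (mul_pos_iff_of_pos_left (inv_pos.2 hn0)).1 hx0
    simp only [hH]
    rw [Set.indicator_of_mem hx, mul_rpow (by positivity) (by positivity), ← mul_assoc,
      ← mul_rpow hn0.le (by positivity)]
    congr 2
    field_simp
  refine tendsto_integral_filter_of_dominated_convergence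
    (fun y => y ^ (-γ) * rexp (-(γ * c') * y)) ?_ ?_ ?_ ?_
  · filter_upwards [eventually_ge_atTop 1] with n hn
    have hn0 : (0 : ℝ) < n := by exact_mod_cast hn
    have hHm : AEMeasurable (H n) volume := by
      rw [hH, aemeasurable_indicator_iff measurableSet_Ioo]
      fun_prop
    have := hHm.comp_quasiMeasurePreserving
      (quasiMeasurePreserving_const_mul (inv_pos.2 hn0).ne')
    exact (this.const_mul _).aestronglyMeasurable.restrict
  · filter_upwards [eventually_ge_atTop 1] with n hn
    have hn0 : (0 : ℝ) < n := by exact_mod_cast hn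
    filter_upwards [ae_restrict_mem measurableSet_Ioi] with y hy
    have hy : 0 < y := hy
    by_cases hx : (n : ℝ)⁻¹ * y ∈ Set.Ioo 0 D
    · rw [hval n y hn hx]
      have hx1 : 0 < 1 - (n : ℝ)⁻¹ * y := sub_pos.2 (hx.2.trans_le hD1)
      have hS0 : 0 < S ((n : ℝ)⁻¹ * y) := (exp_pos _).trans_le (hexp _ hx)
      rw [Real.norm_of_nonneg (by positivity)]
      have h3 : (y / (1 - (n : ℝ)⁻¹ * y)) ^ (-γ) ≤ y ^ (-γ) := by
        refine rpow_le_rpow_of_nonpos hy ?_ (by linarith)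
        rw [le_div_iff₀ hx1]
        have := hx.1
        nlinarith
      have h4 : (S ((n : ℝ)⁻¹ * y) ^ n) ^ (-γ) ≤ rexp (c' * y) ^ (-γ) := by
        refine rpow_le_rpow_of_nonpos (exp_pos _) ?_ (by linarith)
        calc rexp (c' * y) = rexp (c' * ((n : ℝ)⁻¹ * y)) ^ n := by
              rw [← exp_nat_mul]
              congr 1
              field_simp
          _ ≤ _ := pow_le_pow_left₀ (exp_pos _).le (hexp _ hx) n
      have h5 : rexp (c' * y) ^ (-γ) = rexp (-(γ * c') * y) := by
        rw [← exp_mul]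
        congr 1
        ring
      rw [h5] at h4
      exact mul_le_mul h3 h4 (by positivity) (by positivity)
    · simp only [hH]
      rw [Set.indicator_of_notMem hx, mul_zero, norm_zero]
      positivity
  · have := integrableOn_rpow_mul_exp_neg_mul_rpow (p := 1) (s := -γ) (b := γ * c')
      (by linarith) one_pos (by positivity)
    simpa [IntegrableOn] using this
  · filter_upwards [ae_restrict_mem measurableSet_Ioi] with y hy
    have hy : 0 < y := hy
    have e2 : ∀ᶠ n : ℕ in atTop,
        (y / (1 - (n : ℝ)⁻¹ * y)) ^ (-γ) * (S ((n : ℝ)⁻¹ * y) ^ n) ^ (-γ) =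
          (n : ℝ) ^ (-γ) * H n ((n : ℝ)⁻¹ * y) := by
      filter_upwards [eventually_ge_atTop 1, hev y hy] with n hn hx using (hval n y hn hx).symm
    refine Tendsto.congr' e2 (Tendsto.mul ?_ (hφ y hy))
    have h2 : Tendsto (fun n : ℕ => (n : ℝ)⁻¹ * y) atTop (𝓝 0) := by
      simpa using (tendsto_inv_atTop_nhds_zero_nat (𝕜 := ℝ)).mul_const y
    have h3 : Tendsto (fun n : ℕ => y / (1 - (n : ℝ)⁻¹ * y)) atTop (𝓝 y) := by
      have h4 := (tendsto_const_nhds (x := y)).div (h2.const_sub 1) (by simp)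
      rwa [sub_zero, div_one] at h4
    exact h3.rpow_const (Or.inl hy.ne')

/-- The data extracted from an inverse of `ψ_μ`: a positive function `u` with `ψ_μ(-u(x)) = -x`
that also inverts the transforms of all free powers. -/
lemma exists_inverse_psiNeg {μ : Measure ℝ} [IsProbabilityMeasure μ] (h : ∀ᵐ t ∂μ, 0 ≤ t)
    (h0 : ¬ ∀ᵐ t ∂μ, t = 0) {ν : ℕ → Measure ℝ}
    (hν : ∀ n, 1 ≤ n → RealizesFreePower μ (ν n) n) :
    ∃ u : ℝ → ℝ, ∀ x ∈ Set.Ioo 0 (1 - (μ {0}).toReal), 0 < u x ∧ psiNeg μ (u x) = x ∧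
      ∀ n, 1 ≤ n → psiNeg (ν n) (x / (1 - x) * ((1 - x) / x * u x) ^ n) = x := by
  choose! χ hχ hχν using hν
  have aux : ∀ n, 1 ≤ n → ∀ x ∈ Set.Ioo 0 (1 - (μ {0}).toReal),
      0 < -χ n (-x) ∧ psiNeg μ (-χ n (-x)) = x := by
    intro n hn x hx
    obtain ⟨h1, h2⟩ := hχ n hn (-x) ⟨by linarith [hx.2], by linarith [hx.1]⟩
    refine ⟨by linarith, ?_⟩
    have := psi_neg μ (-χ n (-x))
    rw [neg_neg, h2] at this
    linarith
  refine ⟨fun x => -χ 1 (-x), fun x hx => ⟨(aux 1 le_rfl x hx).1, (aux 1 le_rfl x hx).2,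
    fun n hn => ?_⟩⟩
  obtain ⟨p1, q1⟩ := aux 1 le_rfl x hx
  obtain ⟨pn, qn⟩ := aux n hn x hx
  have heq : -χ 1 (-x) = -χ n (-x) := by
    rcases lt_trichotomy (-χ 1 (-x)) (-χ n (-x)) with hlt | heq | hlt
    · exact absurd (psiNeg_lt h p1 hlt h0) (by rw [q1, qn]; exact lt_irrefl x)
    · exact heq
    · exact absurd (psiNeg_lt h pn hlt h0) (by rw [q1, qn]; exact lt_irrefl x)
  have h3 := hχν n hn (-x) ⟨by linarith [hx.2], by linarith [hx.1]⟩
  have hx0 := hx.1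
  have hx1 : 0 < 1 - x := by linarith [hx.2, ENNReal.toReal_nonneg (a := μ {0})]
  have harg : ((-x + 1) / -x) ^ (n - 1) * χ n (-x) ^ n =
      -(x / (1 - x) * ((1 - x) / x * -χ n (-x)) ^ n) := by
    obtain ⟨m, rfl⟩ : ∃ m, n = m + 1 := ⟨n - 1, by omega⟩
    have e1 : (-x + 1) / -x = -((1 - x) / x) := by
      rw [div_neg, neg_add_eq_sub]
    have hq : (1 - x) / x ≠ 0 := by positivity
    rw [e1, Nat.add_sub_cancel, ← inv_div (1 - x) x]
    generalize (1 - x) / x = q at hq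
    rw [show q * -χ (m + 1) (-x) = -q * χ (m + 1) (-x) by ring, mul_pow, pow_succ (-q)]
    field_simp
  rw [harg, psi_neg, neg_inj] at h3
  simp only [heq]
  exact h3

/-- The transform of a free power is bounded by `1 - μ({0})`. -/
lemma psiNeg_le_of_inverse {μ ρ : Measure ℝ} [IsProbabilityMeasure μ] [IsProbabilityMeasure ρ]
    (h : ∀ᵐ t ∂μ, 0 ≤ t) (hρ : ∀ᵐ t ∂ρ, 0 ≤ t) (h0 : ¬ ∀ᵐ t ∂μ, t = 0) {u : ℝ → ℝ} {n : ℕ}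
    (hn : 1 ≤ n) (hu : ∀ x ∈ Set.Ioo 0 (1 - (μ {0}).toReal), 0 < u x ∧ psiNeg μ (u x) = x ∧
      psiNeg ρ (x / (1 - x) * ((1 - x) / x * u x) ^ n) = x) {s : ℝ} (hs : 0 < s) :
    psiNeg ρ s ≤ 1 - (μ {0}).toReal := by
  rcases (ENNReal.toReal_nonneg (a := μ {0})).eq_or_lt with hδ | hδ
  · rw [← hδ, sub_zero]
    exact (psiNeg_le_one_sub_measure_zero hρ hs).trans (sub_le_self _ ENNReal.toReal_nonneg)
  set δ := (μ {0}).toReal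
  by_contra! hlt
  set U := 1 + s / δ ^ (n - 1) with hU
  have hU0 : 0 < U := by positivity
  have hU1 : 1 ≤ U := le_add_of_nonneg_right (by positivity)
  have hUlt : psiNeg μ U < 1 - δ := (psiNeg_lt h hU0 (lt_two_mul_self hU0) h0).trans_le
    (psiNeg_le_one_sub_measure_zero h (by positivity))
  obtain ⟨x, hxU, hxδ⟩ := exists_between hUlt
  have hx0 : 0 < x := (psiNeg_nonneg h hU0.le).trans_lt hxU
  obtain ⟨hux, hinv, hinvρ⟩ := hu x ⟨hx0, hxδ⟩
  have hUu : U ≤ u x := by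
    by_contra! hlt'
    have := psiNeg_mono h hux.le hlt'.le
    rw [hinv] at this
    exact absurd hxU this.not_gt
  have hx1 : 0 < 1 - x := by linarith
  have hbig : s ≤ x / (1 - x) * ((1 - x) / x * u x) ^ n := by
    obtain ⟨m, rfl⟩ : ∃ m, n = m + 1 := ⟨n - 1, by omega⟩
    have e1 : x / (1 - x) * ((1 - x) / x * u x) ^ (m + 1) =
        ((1 - x) / x) ^ m * u x ^ (m + 1) := by
      rw [mul_pow, pow_succ ((1 - x) / x)]
      field_simp
    rw [e1]
    have h1 : δ ^ m ≤ ((1 - x) / x) ^ m := by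
      refine pow_le_pow_left₀ hδ.le ?_ m
      rw [le_div_iff₀ hx0]
      nlinarith
    have h2 : U ≤ u x ^ (m + 1) := hUu.trans (le_self_pow₀ (hU1.trans hUu) (by omega))
    calc s ≤ δ ^ m * U := by
          rw [hU, Nat.add_sub_cancel]
          have : δ ^ m * (1 + s / δ ^ m) = δ ^ m + s := by field_simp
          rw [this]
          exact le_add_of_nonneg_left (by positivity)
      _ ≤ _ := mul_le_mul h1 h2 hU0.le (by positivity)
  have := psiNeg_mono hρ hs.le hbig
  rw [hinvρ] at this
  linarith

/-- A real fractional moment expressed through the inverse `σ` of `psiNeg ρ`. -/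
lemma integral_rpow_eq_of_inverse {ρ : Measure ℝ} [IsFiniteMeasure ρ] (h : ∀ᵐ t ∂ρ, 0 ≤ t)
    {γ D : ℝ} (hγ : γ ∈ Set.Ioo (0 : ℝ) 1) {σ : ℝ → ℝ} (hσ : ∀ x ∈ Set.Ioo 0 D, 0 < σ x)
    (hσm : AEMeasurable σ (volume.restrict (Set.Ioo 0 D)))
    (hinv : ∀ x ∈ Set.Ioo 0 D, psiNeg ρ (σ x) = x) (hD : ∀ s, 0 < s → psiNeg ρ s ≤ D) :
    ∫ t, t ^ γ ∂ρ =
      (Gamma (1 + γ) * Gamma (1 - γ))⁻¹ * ∫ x in Set.Ioo 0 D, σ x ^ (-γ) := by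
  have hG := Gamma_pos_of_pos hγ.1
  have hG' := Gamma_pos_of_pos (sub_pos.2 hγ.2)
  have hγ0 := hγ.1
  have key := congrArg ENNReal.toReal (lintegral_rpow_eq_of_inverse h hγ hσ hinv hD)
  rw [ENNReal.toReal_mul, ENNReal.toReal_ofReal (by positivity),
    ← integral_eq_lintegral_of_nonneg_ae, ← integral_eq_lintegral_of_nonneg_ae,
    integral_div] at key
  · rw [add_comm 1 γ, Gamma_add_one hγ0.ne']
    field_simp
    field_simp at key
    linarith
  · filter_upwards [ae_restrict_mem measurableSet_Ioo] with x hx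
    have := hσ x hx
    simp only [Pi.zero_apply]
    positivity
  · exact ((hσm.pow_const _).div_const _).aestronglyMeasurable
  · filter_upwards [h] with t ht using rpow_nonneg ht _
  · exact Measurable.aestronglyMeasurable (by fun_prop)

/-- Asymptotics of fractional moments of free multiplicative convolution powers, for a
non-Dirac probability measure `μ` on `[0,∞)` with unit mean and `γ ∈ (0,1)`:
if `m₂(μ) < ∞` then `n^{1-γ} m_γ(μ^{⊠n}) → (Var(μ)·γ)^{γ-1}/Γ(1+γ)`, and if
`m₂(μ) = ∞` then `n^{1-γ} m_γ(μ^{⊠n}) → 0`. -/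
theorem fractional_moment_asymptotics_free_power
    (μ : Measure ℝ) [IsProbabilityMeasure μ] (hsupp : μ (Set.Iio 0) = 0)
    (hnd : ∀ a : ℝ, μ ≠ Measure.dirac a)
    (hm1 : Integrable (fun t : ℝ => t) μ) (hmean : ∫ t, t ∂μ = 1)
    (ν : ℕ → Measure ℝ) (hprob : ∀ n, IsProbabilityMeasure (ν n))
    (hνsupp : ∀ n, (ν n) (Set.Iio 0) = 0)
    (hν : ∀ n, 1 ≤ n → RealizesFreePower μ (ν n) n) :
    ∀ γ ∈ Set.Ioo (0 : ℝ) 1,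
      (Integrable (fun t : ℝ => t ^ 2) μ →
        Tendsto (fun n : ℕ => (n : ℝ) ^ ((1 : ℝ) - γ) * ∫ t, t ^ γ ∂(ν n)) atTop
          (𝓝 (((((∫ t, t ^ 2 ∂μ) - (∫ t, t ∂μ) ^ 2) * γ) ^ (γ - 1)) /
            Real.Gamma (1 + γ)))) ∧
      (¬ Integrable (fun t : ℝ => t ^ 2) μ →
        Tendsto (fun n : ℕ => (n : ℝ) ^ ((1 : ℝ) - γ) * ∫ t, t ^ γ ∂(ν n)) atTop
          (𝓝 0)) := by
  intro γ hγ
  have hγ0 := hγ.1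
  have h := ae_nonneg_of_measure_Iio hsupp
  have hne : ¬ ∀ᵐ t ∂μ, t = 0 := by
    intro h0
    have : ∫ t, t ∂μ = 0 := integral_eq_zero_of_ae h0
    rw [hmean] at this
    exact one_ne_zero this
  obtain ⟨u, hu⟩ := exists_inverse_psiNeg h hne hν
  set D := 1 - (μ {0}).toReal with hDdef
  have hD1 : D ≤ 1 := sub_le_self _ ENNReal.toReal_nonneg
  have hD : 0 < D := by
    refine lt_of_lt_of_le ?_ (psiNeg_le_one_sub_measure_zero h one_pos)
    exact (psiNeg_nonneg h zero_le_one).lt_of_ne fun h0 =>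
      hne (ae_eq_zero_of_psiNeg_eq_zero h one_pos h0.symm)
  have hum : MonotoneOn u (Set.Ioo 0 D) := by
    intro x hx y hy hxy
    by_contra! hlt
    have := psiNeg_lt h (hu y hy).1 hlt hne
    rw [(hu x hx).2.1, (hu y hy).2.1] at this
    exact absurd hxy this.not_ge
  have hum' : AEMeasurable u (volume.restrict (Set.Ioo 0 D)) :=
    aemeasurable_restrict_of_monotoneOn measurableSet_Ioo hum
  set S : ℝ → ℝ := fun x => (1 - x) / x * u x with hSdef
  have hSm : AEMeasurable S (volume.restrict (Set.Ioo 0 D)) := by fun_prop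
  set c := (∫ t, (1 - t) ^ 2 / (1 + 1 * t) ∂μ) / 4 with hcdef
  have hc : 0 < c := div_pos (integral_sq_one_sub_div_pos h hnd hm1) (by norm_num)
  have hS : ∀ x ∈ Set.Ioo 0 D, 1 + c * x ≤ S x := by
    intro x hx
    obtain ⟨h1, h2, -⟩ := hu x hx
    have := le_one_sub_div_mul_sub_one h hm1 hmean h1 (by rw [h2]; exact hx.1)
    rwa [h2] at this
  have hS0 : ∀ x ∈ Set.Ioo 0 D, 0 < S x := by
    intro x hx
    have := hS x hx
    have := mul_pos hc hx.1
    linarith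
  have hmom : ∀ᶠ n : ℕ in atTop, (Gamma (1 + γ) * Gamma (1 - γ))⁻¹ * ((n : ℝ) ^ (1 - γ) *
      ∫ x in Set.Ioo 0 D, (x / (1 - x) * S x ^ n) ^ (-γ)) =
        (n : ℝ) ^ (1 - γ) * ∫ t, t ^ γ ∂(ν n) := by
    filter_upwards [eventually_ge_atTop 1] with n hn
    have := hprob n
    have hρ := ae_nonneg_of_measure_Iio (hνsupp n)
    rw [integral_rpow_eq_of_inverse (σ := fun x => x / (1 - x) * S x ^ n) hρ hγ ?_ (by fun_prop)
      (fun x hx => (hu x hx).2.2 n hn)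
      (fun s hs => psiNeg_le_of_inverse h hρ hne hn
        (fun x hx => ⟨(hu x hx).1, (hu x hx).2.1, (hu x hx).2.2 n hn⟩) hs)]
    · ring
    · intro x hx
      have h1 := hS0 x hx
      have h2 := hx.1
      have h3 : 0 < 1 - x := sub_pos.2 (hx.2.trans_le hD1)
      positivity
  have hu0 : Tendsto u (𝓝[>] 0) (𝓝[>] 0) := by
    have hI : ∀ᶠ x in 𝓝[>] (0 : ℝ), x ∈ Set.Ioo 0 D := Ioo_mem_nhdsGT hD
    refine tendsto_nhdsWithin_iff.2 ⟨?_, hI.mono fun x hx => (hu x hx).1⟩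
    rw [Metric.tendsto_nhds]
    intro ε hε
    have hpos : 0 < psiNeg μ ε := (psiNeg_nonneg h hε.le).lt_of_ne fun h0 =>
      hne (ae_eq_zero_of_psiNeg_eq_zero h hε h0.symm)
    filter_upwards [hI, Ioo_mem_nhdsGT hpos] with x hx hx'
    rw [Real.dist_eq, sub_zero, abs_of_pos (hu x hx).1]
    by_contra! hle
    have := psiNeg_mono h hε.le hle
    rw [(hu x hx).2.1] at this
    exact absurd hx'.2 this.not_gt
  obtain ⟨w, hw, hwA⟩ := tendsto_S_sub_one_div h hm1 hmean hu0
  have hexp : ∀ᶠ x in 𝓝[>] (0 : ℝ),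
      w x * ∫ t, (1 - t) ^ 2 / (1 + u x * t) ∂μ = (S x - 1) / x := by
    filter_upwards [hwA, Ioo_mem_nhdsGT hD] with x h1 hx
    rw [(hu x hx).2.1] at h1
    exact (h1 hx.1).symm
  have hscale : ∀ y : ℝ, 0 < y → Tendsto (fun n : ℕ => (n : ℝ)⁻¹ * y) atTop (𝓝[>] 0) := by
    intro y hy
    refine tendsto_nhdsWithin_iff.2 ⟨?_, ?_⟩
    · simpa using (tendsto_inv_atTop_nhds_zero_nat (𝕜 := ℝ)).mul_const y
    · filter_upwards [eventually_ge_atTop 1] with n hn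
      have hn0 : (0 : ℝ) < n := by exact_mod_cast hn
      exact mul_pos (inv_pos.2 hn0) hy
  have hscale' : ∀ y : ℝ, 0 < y → ∀ᶠ n : ℕ in atTop,
      y * ((S ((n : ℝ)⁻¹ * y) - 1) / ((n : ℝ)⁻¹ * y)) = n * (S ((n : ℝ)⁻¹ * y) - 1) := by
    intro y hy
    filter_upwards [eventually_ge_atTop 1] with n hn
    have hn0 : (0 : ℝ) < n := by exact_mod_cast hn
    field_simp
  have hG := Gamma_pos_of_pos hγ0
  have hG' := Gamma_pos_of_pos (sub_pos.2 hγ.2)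
  have hG1 : 0 < Gamma (1 + γ) := Gamma_pos_of_pos (by linarith)
  have hsq : (fun t : ℝ => (1 - t) ^ 2) = fun t => 1 - 2 * t + t ^ 2 := by
    ext t
    ring
  have h12 : Integrable (fun t : ℝ => 1 - 2 * t) μ := (integrable_const 1).sub (hm1.const_mul 2)
  refine ⟨fun hm2 => ?_, fun hm2 => ?_⟩
  · have hi : Integrable (fun t : ℝ => (1 - t) ^ 2) μ := hsq ▸ h12.add hm2
    set V := ∫ t, (1 - t) ^ 2 ∂μ with hV
    have hVeq : (∫ t, t ^ 2 ∂μ) - (∫ t, t ∂μ) ^ 2 = V := by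
      rw [hV, hsq, integral_add h12 hm2, integral_sub (integrable_const 1) (hm1.const_mul 2),
        integral_const_mul, hmean]
      simp
      ring
    have hVpos : 0 < V := by
      refine (integral_sq_one_sub_div_pos h hnd hm1).trans_le ?_
      refine integral_mono_ae (integrable_sq_one_sub_div h hm1 one_pos) hi ?_
      filter_upwards [h] with t ht
      exact div_le_self (sq_nonneg _) (by linarith)
    have hlim : Tendsto (fun x => (S x - 1) / x) (𝓝[>] 0) (𝓝 V) := by
      have := hw.mul ((tendsto_integral_sq_one_sub_div h hi).comp hu0)
      rw [one_mul] at this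
      exact this.congr' hexp
    have hφ : ∀ y, 0 < y → Tendsto (fun n : ℕ => (S ((n : ℝ)⁻¹ * y) ^ n) ^ (-γ)) atTop
        (𝓝 (rexp (-(γ * V * y)))) := by
      intro y hy
      have h1 := ((hlim.comp (hscale y hy)).const_mul y).congr' (hscale' y hy)
      have h2 := (tendsto_one_add_pow_exp_of_tendsto h1).rpow_const (p := -γ)
        (Or.inl (exp_pos _).ne')
      simp only [add_sub_cancel] at h2
      rw [← exp_mul] at h2
      convert h2 using 3
      ring
    have hmain := (tendsto_rpow_mul_integral hγ hD hD1 hc hSm hS hφ).const_mul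
      (Gamma (1 + γ) * Gamma (1 - γ))⁻¹
    have hint := integral_rpow_mul_exp_neg_mul_Ioi (a := 1 - γ) (r := γ * V) (sub_pos.2 hγ.2)
      (by positivity)
    rw [sub_sub_cancel_left] at hint
    rw [hint] at hmain
    rw [hVeq]
    convert hmain.congr' hmom using 2
    rw [one_div, inv_rpow (by positivity), ← rpow_neg (by positivity), neg_sub, mul_comm V γ]
    field_simp
  · have hi : ¬ Integrable (fun t : ℝ => (1 - t) ^ 2) μ := by
      intro hi
      refine hm2 ((hi.sub h12).congr (ae_of_all _ fun t => ?_))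
      simp only [Pi.sub_apply]
      ring
    have hlim : Tendsto (fun x => (S x - 1) / x) (𝓝[>] 0) atTop :=
      (hw.pos_mul_atTop one_pos
        ((tendsto_integral_sq_one_sub_div_atTop h hm1 hi).comp hu0)).congr' hexp
    have hφ : ∀ y, 0 < y → Tendsto (fun n : ℕ => (S ((n : ℝ)⁻¹ * y) ^ n) ^ (-γ)) atTop
        (𝓝 0) := by
      intro y hy
      have h1 := ((hlim.comp (hscale y hy)).const_mul_atTop hy).congr' (hscale' y hy)
      refine (tendsto_rpow_neg_atTop hγ0).comp (tendsto_atTop_mono' _ ?_ h1)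
      filter_upwards [(hscale y hy).eventually (Ioo_mem_nhdsGT hD)] with n hn
      have h2 := one_add_mul_le_pow (a := S ((n : ℝ)⁻¹ * y) - 1)
        (by linarith [hS0 _ hn]) n
      rw [add_sub_cancel] at h2
      linarith
    have hmain := (tendsto_rpow_mul_integral hγ hD hD1 hc hSm hS hφ).const_mul
      (Gamma (1 + γ) * Gamma (1 - γ))⁻¹
    simp only [mul_zero, integral_zero] at hmain
    exact hmain.congr' hmom
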